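/- Let A be m×n, B be m×k, A' be m'×n, and B' be m'×k' matrices over R. Then (B | A) ≤ₙ (B' | A') if and only if for every right R-module K and every left R-module M, the following holds: for every a ∈ Kⁿ for which there exists c ∈ K^{m'} with c·A' = a and c·B' = 0 (i.e. for every j, Σᵢ cᵢ·A'ᵢⱼ = aⱼ and Σᵢ cᵢ·B'ᵢⱼ = 0), and for every b ∈ Mⁿ for which there exists d ∈ Mᵏ with B·d = A·b (i.e. for every i, Σⱼ Bᵢⱼ·dⱼ = Σⱼ Aᵢⱼ·bⱼ), one has Σᵢ₌₁ⁿ aᵢ ⊗ bᵢ = 0 in the tensor product K ⊗_R M. -/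

import Mathlib

universe u

/-- `(B | A) ≤ₙ (B' | A')`: there exist matrices `U`, `V`, `G` with
`U * B = B' * V` and `U * A = A' + B' * G`. -/
def MatPairLE (R : Type*) [Ring R] {m k m' k' n : Type*}
    [Fintype m] [Fintype k']
    (B : Matrix m k R) (A : Matrix m n R)
    (B' : Matrix m' k' R) (A' : Matrix m' n R) : Prop :=
  ∃ (U : Matrix m' m R) (V : Matrix k' k R) (G : Matrix k' n R),
    U * B = B' * V ∧ U * A = A' + B' * G

/-- `Σᵢ aᵢ ⊗ bᵢ = 0` in the tensor product `K ⊗_R M` of a right `R`-module `K` and a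
left `R`-module `M`: every `R`-balanced biadditive map kills `Σᵢ (aᵢ, bᵢ)`.  (Since
Mathlib's `TensorProduct` requires a commutative base ring, the noncommutative tensor
product is characterized here by its universal property.) -/
def SumTmulEqZero (R : Type u) [Ring R]
    (K : Type u) [AddCommGroup K] [Module Rᵐᵒᵖ K]
    (M : Type u) [AddCommGroup M] [Module R M]
    {n : ℕ} (a : Fin n → K) (b : Fin n → M) : Prop :=
  ∀ (P : Type u) [AddCommGroup P] (φ : K →+ M →+ P),
    (∀ (r : R) (x : K) (y : M), φ (MulOpposite.op r • x) y = φ x (r • y)) →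
    ∑ i, φ (a i) (b i) = 0

open Matrix MulOpposite

section TensorOfQuotients

variable {R : Type*} [Ring R]

/-- The left submodule of row vectors spanned by the rows of `C`. -/
def rowSubmodule {m N : Type*} [Fintype m] (C : Matrix m N R) : Submodule R (N → R) :=
  LinearMap.range C.vecMulLinear

/-- The right submodule of column vectors spanned by the columns of `B`. -/
def colSubmodule {m k : Type*} [Fintype k] (B : Matrix m k R) : Submodule Rᵐᵒᵖ (m → R) where
  carrier := Set.range B.mulVec
  add_mem' := by
    rintro _ _ ⟨x, rfl⟩ ⟨y, rfl⟩
    exact ⟨x + y, mulVec_add B x y⟩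
  zero_mem' := ⟨0, mulVec_zero B⟩
  smul_mem' := by
    rintro r _ ⟨x, rfl⟩
    exact ⟨r • x, mulVec_smul B r x⟩

/-- The additive subgroup of matrices of the form `B * X + U * C`. -/
def sandwichSubgroup {m' k' m N : Type*} [Fintype k'] [Fintype m]
    (B : Matrix m' k' R) (C : Matrix m N R) : AddSubgroup (Matrix m' N R) where
  carrier := {Z | ∃ (X : Matrix k' N R) (U : Matrix m' m R), Z = B * X + U * C}
  add_mem' := by
    rintro _ _ ⟨X, U, rfl⟩ ⟨Y, W, rfl⟩
    exact ⟨X + Y, U + W, by rw [Matrix.mul_add, Matrix.add_mul]; abel⟩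
  zero_mem' := ⟨0, 0, by simp⟩
  neg_mem' := by
    rintro _ ⟨X, U, rfl⟩
    exact ⟨-X, -U, by rw [Matrix.mul_neg, Matrix.neg_mul]; abel⟩

/-- The outer product of column and row vectors, as a biadditive map into matrices modulo
`sandwichSubgroup B C`. -/
def outerProductHom {m' k' m N : Type*} [Fintype k'] [Fintype m]
    (B : Matrix m' k' R) (C : Matrix m N R) :
    (m' → R) →+ (N → R) →+ Matrix m' N R ⧸ sandwichSubgroup B C :=
  AddMonoidHom.mk' (fun x => AddMonoidHom.mk'
      (fun y => (QuotientAddGroup.mk (vecMulVec x y) : Matrix m' N R ⧸ sandwichSubgroup B C))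
      fun y z => by rw [vecMulVec_add, QuotientAddGroup.mk_add])
    fun x z => by
      ext y
      simp [add_vecMulVec]

/-- The biadditive map induced by the outer product on the quotients by the column space of `B`
and the row space of `C`. -/
def quotientOuterProductHom {m' k' m N : Type*} [Fintype k'] [Fintype m]
    (B : Matrix m' k' R) (C : Matrix m N R) :
    ((m' → R) ⧸ colSubmodule B) →+ ((N → R) ⧸ rowSubmodule C) →+
      Matrix m' N R ⧸ sandwichSubgroup B C :=
  QuotientAddGroup.lift (colSubmodule B).toAddSubgroup
    (AddMonoidHom.mk' (fun x => QuotientAddGroup.lift (rowSubmodule C).toAddSubgroup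
        (outerProductHom B C x) (by
          rintro _ ⟨u, rfl⟩
          refine (QuotientAddGroup.eq_zero_iff _).2 ⟨0, vecMulVec x u, ?_⟩
          rw [Matrix.mul_zero, zero_add, vecMulVec_mul]
          rfl))
      fun x z => by
        ext y
        obtain ⟨y, rfl⟩ := QuotientAddGroup.mk_surjective y
        exact congrArg (· y) (map_add (outerProductHom B C) x z))
    (by
      rintro _ ⟨u, rfl⟩
      ext y
      obtain ⟨y, rfl⟩ := QuotientAddGroup.mk_surjective y
      refine (QuotientAddGroup.eq_zero_iff (N := sandwichSubgroup B C) _).2 ⟨vecMulVec u y, 0, ?_⟩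
      rw [Matrix.zero_mul, add_zero, mul_vecMulVec])

theorem quotientOuterProductHom_mk {m' k' m N : Type*} [Fintype k'] [Fintype m]
    (B : Matrix m' k' R) (C : Matrix m N R) (x : m' → R) (y : N → R) :
    quotientOuterProductHom B C (Submodule.Quotient.mk x) (Submodule.Quotient.mk y) =
      QuotientAddGroup.mk (vecMulVec x y) :=
  rfl

theorem quotientOuterProductHom_balanced {m' k' m N : Type*} [Fintype k'] [Fintype m]
    (B : Matrix m' k' R) (C : Matrix m N R) (r : R)
    (x : (m' → R) ⧸ colSubmodule B) (y : (N → R) ⧸ rowSubmodule C) :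
    quotientOuterProductHom B C (op r • x) y = quotientOuterProductHom B C x (r • y) := by
  obtain ⟨x, rfl⟩ := Submodule.Quotient.mk_surjective _ x
  obtain ⟨y, rfl⟩ := Submodule.Quotient.mk_surjective _ y
  rw [← Submodule.Quotient.mk_smul, ← Submodule.Quotient.mk_smul, quotientOuterProductHom_mk,
    quotientOuterProductHom_mk]
  congr 1
  ext i j
  simp [vecMulVec_apply, mul_assoc]

end TensorOfQuotients

/-- `(B | A) ≤ₙ (B' | A')` forces the tensor `Σᵢ aᵢ ⊗ bᵢ` to vanish. -/
theorem MatPairLE.sumTmulEqZero {R : Type u} [Ring R] {m k m' k' n : ℕ}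
    {B : Matrix (Fin m) (Fin k) R} {A : Matrix (Fin m) (Fin n) R}
    {B' : Matrix (Fin m') (Fin k') R} {A' : Matrix (Fin m') (Fin n) R}
    (h : MatPairLE R B A B' A')
    {K : Type u} [AddCommGroup K] [Module Rᵐᵒᵖ K] {M : Type u} [AddCommGroup M] [Module R M]
    {a : Fin n → K} {b : Fin n → M} {c : Fin m' → K} {d : Fin k → M}
    (ha : ∀ j, ∑ i, op (A' i j) • c i = a j) (hc : ∀ j, ∑ i, op (B' i j) • c i = 0)
    (hd : ∀ i, ∑ j, B i j • d j = ∑ j, A i j • b j) : SumTmulEqZero R K M a b := by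
  obtain ⟨U, V, G, hUB, hUA⟩ := h
  intro P _ φ hφ
  have smul_mul {p q r : ℕ} (S : Matrix (Fin p) (Fin q) R) (T : Matrix (Fin q) (Fin r) R)
      (v : Fin r → M) (i : Fin p) :
      ∑ j, (S * T) i j • v j = ∑ l, S i l • ∑ j, T l j • v j := by
    simp only [Matrix.mul_apply, Finset.sum_smul, Finset.smul_sum, mul_smul]
    exact Finset.sum_comm
  have move {r : ℕ} (S : Matrix (Fin m') (Fin r) R) (v : Fin r → M) :
      ∑ i, φ (c i) (∑ j, S i j • v j) = ∑ j, φ (∑ i, op (S i j) • c i) (v j) := by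
    simp only [map_sum, AddMonoidHom.finsetSum_apply, hφ]
    exact Finset.sum_comm
  have kill (v : Fin k' → M) : ∑ i, φ (c i) (∑ j, B' i j • v j) = 0 := by
    simp only [move, hc, map_zero, AddMonoidHom.zero_apply, Finset.sum_const_zero]
  have key (i : Fin m') : ∑ j, A' i j • b j =
      ∑ l, B' i l • ∑ j, V l j • d j - ∑ l, B' i l • ∑ j, G l j • b j := by
    rw [← smul_mul, ← smul_mul, ← hUB, smul_mul, eq_sub_iff_add_eq, ← Finset.sum_add_distrib]
    simp only [hd, ← smul_mul, hUA, Matrix.add_apply, add_smul]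
  calc ∑ j, φ (a j) (b j) = ∑ i, φ (c i) (∑ j, A' i j • b j) := by simp only [move, ha]
    _ = 0 := by simp only [key, map_sub, Finset.sum_sub_distrib, kill, sub_zero]

/-- `(B | A) ≤ₙ (B' | A')` iff for every right `R`-module `K` and left `R`-module `M`,
every `a ∈ Kⁿ` in the subgroup dual-defined by `(B' | A')` and every `b ∈ Mⁿ` in the
subgroup defined by `(B | A)` satisfy `Σᵢ aᵢ ⊗ bᵢ = 0` in `K ⊗_R M`. -/
theorem matPairLE_iff_tensor_vanishing {R : Type u} [Ring R] {m k m' k' n : ℕ}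
    (B : Matrix (Fin m) (Fin k) R) (A : Matrix (Fin m) (Fin n) R)
    (B' : Matrix (Fin m') (Fin k') R) (A' : Matrix (Fin m') (Fin n) R) :
    MatPairLE R B A B' A' ↔
      ∀ (K : Type u) [AddCommGroup K] [Module Rᵐᵒᵖ K]
        (M : Type u) [AddCommGroup M] [Module R M]
        (a : Fin n → K) (b : Fin n → M),
        (∃ c : Fin m' → K,
          (∀ j, ∑ i, MulOpposite.op (A' i j) • c i = a j) ∧
          (∀ j : Fin k', ∑ i, MulOpposite.op (B' i j) • c i = 0)) →
        (∃ d : Fin k → M, ∀ i, ∑ j, B i j • d j = ∑ j, A i j • b j) →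
        SumTmulEqZero R K M a b := by
  refine ⟨fun h K _ _ M _ _ a b ⟨c, ha, hc⟩ ⟨d, hd⟩ => h.sumTmulEqZero ha hc hd, fun h => ?_⟩
  let C : Matrix (Fin m) (Fin k ⊕ Fin n) R := fromCols B (-A)
  have sum_single (v : Fin m' → R) :
      ∑ i, op (v i) • (Pi.single i 1 : Fin m' → R) = v := by
    ext l
    simp [Finset.sum_apply, Pi.single_apply]
  have key := h ((Fin m' → R) ⧸ colSubmodule B') ((Fin k ⊕ Fin n → R) ⧸ rowSubmodule C)
    (fun j => Submodule.Quotient.mk fun i => A' i j)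
    (fun j => Submodule.Quotient.mk (Pi.single (Sum.inr j) 1))
    ⟨fun i => Submodule.Quotient.mk (Pi.single i 1), fun j => ?_, fun j => ?_⟩
    ⟨fun j => Submodule.Quotient.mk (Pi.single (Sum.inl j) 1), fun i => ?_⟩
    (Matrix (Fin m') (Fin k ⊕ Fin n) R ⧸ sandwichSubgroup B' C)
    (quotientOuterProductHom B' C) (quotientOuterProductHom_balanced B' C)
  · simp only [quotientOuterProductHom_mk, ← QuotientAddGroup.mk_sum] at key
    obtain ⟨X, U, hXU⟩ := (QuotientAddGroup.eq_zero_iff _).1 key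
    have entry (i : Fin m') (s : Fin k ⊕ Fin n) := congrFun (congrFun hXU i) s
    refine ⟨-U, X.submatrix id Sum.inl, -X.submatrix id Sum.inr, ?_, ?_⟩
    · ext i j
      have e := entry i (Sum.inl j)
      simp [Matrix.sum_apply, vecMulVec_apply, Matrix.mul_apply, C] at e
      simp [Matrix.mul_apply]
      exact (eq_neg_of_add_eq_zero_left e.symm).symm
    · ext i j
      have e := entry i (Sum.inr j)
      simp [Matrix.sum_apply, vecMulVec_apply, Matrix.mul_apply, C, Pi.single_apply] at e
      simp [Matrix.mul_apply, e]
  · simp only [← Submodule.mkQ_apply, ← map_smul, ← map_sum, sum_single]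
  · simp only [← Submodule.mkQ_apply, ← map_smul, ← map_sum, sum_single]
    refine (Submodule.Quotient.mk_eq_zero (colSubmodule B')).2 ⟨Pi.single j 1, ?_⟩
    ext i
    simp
  · simp only [← Submodule.mkQ_apply, ← map_smul, ← map_sum]
    refine (Submodule.Quotient.eq (rowSubmodule C)).2 ⟨Pi.single i 1, ?_⟩
    ext (j | j) <;> simp [C, Finset.sum_apply, Pi.single_apply]
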